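/- Fix (x₀, y₀) ∈ ℒ_M × ℕ and let P₀ ∈ E be the family with (P₀)_{y₀}^{x₀} = 1 and all other entries 0. Then there exists a unique continuous function P : [0,∞) → E such that P(t) = P₀ + ∫₀ᵗ Ψ₊(s, P(s)) ds (Bochner integral in E) for all t ≥ 0. Moreover this solution satisfies P_j^i(t) ≥ 0 for all i ∈ ℒ_M, j ∈ ℕ and t ≥ 0, and |P(t)| = Σ_{i,j} P_j^i(t) = 1 for all t ≥ 0. -/

import Mathlib

open scoped BigOperators
open MeasureTheory Set

/-- The drift `Ψ` of the Fokker–Planck equation of the discrete SLI model, defined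
componentwise on families `x : ℒ_M × ℕ → ℝ`; the convention that a ratio vanishes when
`Σ_l f(l) x_l` (equivalently, for nonnegative `x`, `Σ_l x_l`) vanishes is automatic from
the convention `a / 0 = 0`. -/
noncomputable def PsiFun (M : ℕ) (μ : Fin (M + 1) → ℕ → ℕ → ℝ)
    (lam : ℝ → Fin (M + 1) → ℝ) (f : ℕ → ℝ)
    (t : ℝ) (x : Fin (M + 1) × ℕ → ℝ) (p : Fin (M + 1) × ℕ) : ℝ :=
  (∑' k : ℕ, μ p.1 k p.2 * x (p.1, k))
    + (if 1 ≤ (p.1 : ℕ) then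
        lam t (p.1 - 1) * f p.2 * x (p.1 - 1, p.2) *
          (∑' l : ℕ, x (p.1 - 1, l)) / (∑' l : ℕ, f l * x (p.1 - 1, l))
      else 0)
    - (if (p.1 : ℕ) < M then
        lam t p.1 * f p.2 * x (p.1, p.2) *
          (∑' l : ℕ, x (p.1, l)) / (∑' l : ℕ, f l * x (p.1, l))
      else 0)

/-- The Banach space `E = ℓ¹(ℒ_M × ℕ)`. -/
noncomputable abbrev SLIl1 (M : ℕ) := lp (fun _ : Fin (M + 1) × ℕ => ℝ) 1

section Caratheodory

variable {E : Type*} [NormedAddCommGroup E] [NormedSpace ℝ E]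

omit [NormedSpace ℝ E] in
theorem intervalIntegrable_caratheodory {F : ℝ → E → E} {L : ℝ}
    (hlip : ∀ t x y, ‖F t x - F t y‖ ≤ L * ‖x - y‖) (hzero : ∀ t, F t 0 = 0)
    (hmeas : ∀ u : ℝ → E, Continuous u → AEStronglyMeasurable (fun s => F s (u s)) volume)
    {u : ℝ → E} (hu : Continuous u) (a b : ℝ) :
    IntervalIntegrable (fun s => F s (u s)) volume a b := by
  have hb : IntervalIntegrable (fun s => L * ‖u s‖) volume a b :=
    (hu.norm.const_mul L).intervalIntegrable a b
  refine hb.mono_fun' (hmeas u hu).restrict (Filter.Eventually.of_forall fun s => ?_)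
  simpa [hzero] using hlip s (u s) 0

theorem norm_integral_le_half_exp {g : ℝ → E} {L C t : ℝ} (ht : 0 ≤ t) (hC : 0 ≤ C)
    (hg : ∀ s, ‖g s‖ ≤ L * (Real.exp (2 * L * s) * C)) :
    ‖∫ s in (0 : ℝ)..t, g s‖ ≤ C / 2 * Real.exp (2 * L * t) := by
  have hcont : Continuous fun s => L * (Real.exp (2 * L * s) * C) := by fun_prop
  have h1 := intervalIntegral.norm_integral_le_of_norm_le ht
    (Filter.Eventually.of_forall fun s _ => hg s) (hcont.intervalIntegrable (μ := volume) 0 t)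
  have h2 : ∫ s in (0 : ℝ)..t, L * (Real.exp (2 * L * s) * C)
      = C / 2 * Real.exp (2 * L * t) - C / 2 * Real.exp (2 * L * 0) := by
    refine intervalIntegral.integral_eq_sub_of_hasDerivAt (f := fun s => C / 2 * Real.exp (2 * L * s))
      (fun s _ => ?_) (hcont.intervalIntegrable 0 t)
    have h := (((hasDerivAt_id s).const_mul (2 * L)).exp).const_mul (C / 2)
    convert! h using 1
    simp
    ring
  rw [h2] at h1
  have : 0 ≤ C / 2 * Real.exp (2 * L * 0) := by positivity
  linarith

theorem eq_zero_of_le_mul_integral {φ : ℝ → ℝ} {L : ℝ} (hφ : Continuous φ)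
    (hnonneg : ∀ t, 0 ≤ φ t) (hle : ∀ t, 0 ≤ t → φ t ≤ L * ∫ s in (0 : ℝ)..t, φ s)
    {t : ℝ} (ht : 0 ≤ t) : φ t = 0 := by
  have hder : ∀ x, HasDerivAt (fun t => ∫ s in (0 : ℝ)..t, φ s) (φ x) x := fun x =>
    intervalIntegral.integral_hasDerivAt_right (hφ.intervalIntegrable _ _)
      (hφ.stronglyMeasurableAtFilter _ _) hφ.continuousAt
  have h0 : ∫ s in (0 : ℝ)..t, φ s = 0 := by
    refine eq_zero_of_abs_deriv_le_mul_abs_self_of_eq_zero_right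
      (f := fun t => ∫ s in (0 : ℝ)..t, φ s) (f' := φ) (K := L)
      (fun x _ => (hder x).continuousAt.continuousWithinAt)
      (fun x _ => (hder x).hasDerivWithinAt) (by simp) (fun x hx => ?_) t ⟨ht, le_rfl⟩
    have h0 : 0 ≤ ∫ s in (0 : ℝ)..x, φ s :=
      intervalIntegral.integral_nonneg hx.1 fun s _ => hnonneg s
    rw [Real.norm_of_nonneg (hnonneg x), Real.norm_of_nonneg h0]
    exact hle x hx.1
  have := hle t ht
  rw [h0, mul_zero] at this
  exact le_antisymm this (hnonneg t)

theorem caratheodory_unique {F : ℝ → E → E} {L : ℝ}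
    (hlip : ∀ t x y, ‖F t x - F t y‖ ≤ L * ‖x - y‖) (hzero : ∀ t, F t 0 = 0)
    (hmeas : ∀ u : ℝ → E, Continuous u → AEStronglyMeasurable (fun s => F s (u s)) volume)
    {x₀ : E} {P Q : ℝ → E} (hP : ContinuousOn P (Ici 0)) (hQ : ContinuousOn Q (Ici 0))
    (hPe : ∀ t, 0 ≤ t → P t = x₀ + ∫ s in (0 : ℝ)..t, F s (P s))
    (hQe : ∀ t, 0 ≤ t → Q t = x₀ + ∫ s in (0 : ℝ)..t, F s (Q s)) : EqOn P Q (Ici 0) := by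
  have hext : ∀ R : ℝ → E, ContinuousOn R (Ici 0) → Continuous fun t => R (max t 0) := fun R hR =>
    hR.comp_continuous (by fun_prop) fun t => le_max_right t 0
  have hint : ∀ R : ℝ → E, ∀ t, 0 ≤ t →
      ∫ s in (0 : ℝ)..t, F s (R s) = ∫ s in (0 : ℝ)..t, F s (R (max s 0)) := fun R t ht => by
    refine intervalIntegral.integral_congr fun s hs => ?_
    rw [uIcc_of_le ht] at hs
    simp [max_eq_left hs.1]
  intro t ht
  have hcont := ((hext P hP).sub (hext Q hQ)).norm
  have key := eq_zero_of_le_mul_integral (φ := fun t => ‖P (max t 0) - Q (max t 0)‖) (L := L)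
    hcont (fun _ => norm_nonneg _) (fun r hr => by
      have e : P r - Q r = ∫ s in (0 : ℝ)..r, (F s (P (max s 0)) - F s (Q (max s 0))) := by
        rw [intervalIntegral.integral_sub
          (intervalIntegrable_caratheodory hlip hzero hmeas (hext P hP) 0 r)
          (intervalIntegrable_caratheodory hlip hzero hmeas (hext Q hQ) 0 r),
          hPe r hr, hQe r hr, hint P r hr, hint Q r hr]
        abel
      simp only [max_eq_left hr]
      rw [e, ← intervalIntegral.integral_const_mul]
      exact intervalIntegral.norm_integral_le_of_norm_le hr
        (Filter.Eventually.of_forall fun s _ => hlip s _ _)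
        ((hcont.const_mul L).intervalIntegrable 0 r)) ht
  have ht' : max t 0 = t := max_eq_left ht
  simp only [ht'] at key
  exact sub_eq_zero.1 (norm_eq_zero.1 key)

theorem caratheodory_exists [CompleteSpace E] {F : ℝ → E → E} {L : ℝ} (hL : 0 < L)
    (hlip : ∀ t x y, ‖F t x - F t y‖ ≤ L * ‖x - y‖) (hzero : ∀ t, F t 0 = 0)
    (hmeas : ∀ u : ℝ → E, Continuous u → AEStronglyMeasurable (fun s => F s (u s)) volume)
    (x₀ : E) :
    ∃ P : ℝ → E, Continuous P ∧ ∀ t, 0 ≤ t → P t = x₀ + ∫ s in (0 : ℝ)..t, F s (P s) := by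
  let w : BoundedContinuousFunction ℝ E → ℝ → E := fun u s => Real.exp (2 * L * s) • u s
  have hw : ∀ u, Continuous (w u) := fun u => by
    have := u.continuous
    fun_prop
  have hii : ∀ u a b, IntervalIntegrable (fun s => F s (w u s)) volume a b := fun u a b =>
    intervalIntegrable_caratheodory hlip hzero hmeas (hw u) a b
  have hnw : ∀ u s, ‖w u s‖ ≤ Real.exp (2 * L * s) * ‖u‖ := fun u s => by
    rw [norm_smul, Real.norm_of_nonneg (Real.exp_pos _).le]
    gcongr
    exact u.norm_coe_le_norm s
  let I : BoundedContinuousFunction ℝ E → ℝ → E := fun u t => ∫ s in (0 : ℝ)..t, F s (w u s)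
  have hI : ∀ u, Continuous (I u) := fun u =>
    intervalIntegral.continuous_primitive (hii u) 0
  let T₀ : BoundedContinuousFunction ℝ E → ℝ → E := fun u t =>
    Real.exp (-(2 * L * max t 0)) • (x₀ + I u (max t 0))
  have hT₀ : ∀ u, Continuous (T₀ u) := fun u => by
    have := hI u
    fun_prop
  have hexp : ∀ t : ℝ, ‖Real.exp (-(2 * L * t))‖ * Real.exp (2 * L * t) = 1 := fun t => by
    rw [Real.norm_of_nonneg (Real.exp_pos _).le, ← Real.exp_add]
    simp
  have hT₀b : ∀ u t, ‖T₀ u t‖ ≤ ‖x₀‖ + ‖u‖ / 2 := fun u t => by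
    have ht : 0 ≤ max t 0 := le_max_right t 0
    have h1 : ‖I u (max t 0)‖ ≤ ‖u‖ / 2 * Real.exp (2 * L * max t 0) :=
      norm_integral_le_half_exp ht (norm_nonneg u) fun s => by
        have := hlip s (w u s) 0
        rw [hzero, sub_zero, sub_zero] at this
        exact this.trans (by gcongr; exact hnw u s)
    have h2 : 1 ≤ Real.exp (2 * L * max t 0) := Real.one_le_exp (by positivity)
    calc ‖T₀ u t‖ = ‖Real.exp (-(2 * L * max t 0))‖ * ‖x₀ + I u (max t 0)‖ := norm_smul _ _
      _ ≤ ‖Real.exp (-(2 * L * max t 0))‖ *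
          ((‖x₀‖ + ‖u‖ / 2) * Real.exp (2 * L * max t 0)) := by
        gcongr
        refine (norm_add_le _ _).trans ?_
        nlinarith [norm_nonneg x₀]
      _ = (‖x₀‖ + ‖u‖ / 2) * (‖Real.exp (-(2 * L * max t 0))‖ * Real.exp (2 * L * max t 0)) := by
        ring
      _ = ‖x₀‖ + ‖u‖ / 2 := by rw [hexp, mul_one]
  let T : BoundedContinuousFunction ℝ E → BoundedContinuousFunction ℝ E := fun u =>
    BoundedContinuousFunction.ofNormedAddCommGroup (T₀ u) (hT₀ u) _ (hT₀b u)
  have hT : ContractingWith (1 / 2) T := by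
    refine ⟨by
      rw [← NNReal.coe_lt_coe]
      norm_num, LipschitzWith.of_dist_le_mul fun u v => ?_⟩
    rw [BoundedContinuousFunction.dist_le (by positivity)]
    intro t
    have ht : 0 ≤ max t 0 := le_max_right t 0
    have h1 : ‖I u (max t 0) - I v (max t 0)‖ ≤ ‖u - v‖ / 2 * Real.exp (2 * L * max t 0) := by
      have e : I u (max t 0) - I v (max t 0)
          = ∫ s in (0 : ℝ)..max t 0, (F s (w u s) - F s (w v s)) :=
        (intervalIntegral.integral_sub (hii u _ _) (hii v _ _)).symm
      rw [e]
      refine norm_integral_le_half_exp ht (norm_nonneg _) fun s => ?_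
      refine (hlip s _ _).trans ?_
      gcongr
      have := hnw (u - v) s
      simpa [w, smul_sub] using this
    have e2 : T u t - T v t
        = Real.exp (-(2 * L * max t 0)) • (I u (max t 0) - I v (max t 0)) := by
      change T₀ u t - T₀ v t = _
      simp only [T₀, ← smul_sub]
      congr 1
      abel
    rw [dist_eq_norm, dist_eq_norm, e2, norm_smul]
    calc _ ≤ ‖Real.exp (-(2 * L * max t 0))‖ * (‖u - v‖ / 2 * Real.exp (2 * L * max t 0)) := by
          gcongr
      _ = ‖u - v‖ / 2 * (‖Real.exp (-(2 * L * max t 0))‖ * Real.exp (2 * L * max t 0)) := by ring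
      _ = ‖u - v‖ / 2 := by rw [hexp, mul_one]
      _ = _ := by
        push_cast
        ring
  obtain ⟨u, hu⟩ : ∃ u, T u = u := ⟨_, hT.fixedPoint_isFixedPt⟩
  refine ⟨w u, hw u, fun t ht => ?_⟩
  have h : T₀ u t = u t := congrArg (fun v : BoundedContinuousFunction ℝ E => v t) hu
  change Real.exp (2 * L * t) • u t = _
  rw [← h]
  simp only [T₀, max_eq_left ht]
  rw [smul_smul, ← Real.exp_add]
  simp [I]

end Caratheodory

section SummableFamilies

variable {α : Type*}

theorem summable_abs_lp_one (x : lp (fun _ : α => ℝ) 1) : Summable fun a => |x a| := by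
  simpa using x.2.summable

theorem norm_lp_one (x : lp (fun _ : α => ℝ) 1) : ‖x‖ = ∑' a, |x a| := by
  simpa using lp.norm_rpow_eq_tsum (p := 1) (by simp) x

theorem memℓp_one_of_summable {g : α → ℝ} (hg : Summable fun a => |g a|) :
    Memℓp (E := fun _ : α => ℝ) g 1 :=
  memℓp_gen (by simpa using hg)

/-- The componentwise positive part on `ℓ¹`. -/
noncomputable def lpOnePos (x : lp (fun _ : α => ℝ) 1) : lp (fun _ : α => ℝ) 1 :=
  ⟨fun a => max (x a) 0, memℓp_one_of_summable <|
    (summable_abs_lp_one x).of_nonneg_of_le (fun _ => abs_nonneg _) fun a => by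
      simpa using abs_max_sub_max_le_abs (x a) 0 0⟩

theorem lpOnePos_apply (x : lp (fun _ : α => ℝ) 1) (a : α) : lpOnePos x a = max (x a) 0 := rfl

theorem norm_lpOnePos_sub_le (x y : lp (fun _ : α => ℝ) 1) :
    ‖lpOnePos x - lpOnePos y‖ ≤ ‖x - y‖ := by
  rw [norm_lp_one, norm_lp_one]
  refine (summable_abs_lp_one (lpOnePos x - lpOnePos y)).tsum_le_tsum (fun a => ?_)
    (summable_abs_lp_one (x - y))
  exact abs_max_sub_max_le_abs (x a) (y a) 0

variable {F G : Type*} [NormedAddCommGroup F] [NormedSpace ℝ F] [CompleteSpace F]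
  [NormedAddCommGroup G] [NormedSpace ℝ G]

omit [CompleteSpace F] in
theorem summable_norm_smul_lp_one {v : α → F} {C : ℝ} (hv : ∀ a, ‖v a‖ ≤ C)
    (x : lp (fun _ : α => ℝ) 1) : Summable fun a => ‖x a • v a‖ :=
  ((summable_abs_lp_one x).mul_right C).of_nonneg_of_le (fun _ => norm_nonneg _) fun a => by
    rw [norm_smul, Real.norm_eq_abs]
    exact mul_le_mul_of_nonneg_left (hv a) (abs_nonneg _)

/-- The continuous linear map on `ℓ¹` sending the `a`-th unit vector to `v a`. -/
noncomputable def lpOneLift (v : α → F) (C : ℝ) (hv : ∀ a, ‖v a‖ ≤ C) :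
    lp (fun _ : α => ℝ) 1 →L[ℝ] F :=
  LinearMap.mkContinuous
    { toFun x := ∑' a, x a • v a
      map_add' x y := by
        rw [← Summable.tsum_add (summable_norm_smul_lp_one hv x).of_norm
          (summable_norm_smul_lp_one hv y).of_norm]
        exact tsum_congr fun a => add_smul _ _ _
      map_smul' c x := by
        rw [RingHom.id_apply, ← Summable.tsum_const_smul c (summable_norm_smul_lp_one hv x).of_norm]
        exact tsum_congr fun a => mul_smul _ _ _ }
    C fun x => by
      rw [norm_lp_one, ← tsum_mul_left]
      refine (norm_tsum_le_tsum_norm (summable_norm_smul_lp_one hv x)).trans ?_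
      refine (summable_norm_smul_lp_one hv x).tsum_le_tsum (fun a => ?_)
        ((summable_abs_lp_one x).mul_left C)
      rw [norm_smul, Real.norm_eq_abs, mul_comm]
      exact mul_le_mul_of_nonneg_right (hv a) (abs_nonneg _)

theorem lpOneLift_apply (v : α → F) (C : ℝ) (hv : ∀ a, ‖v a‖ ≤ C) (x : lp (fun _ : α => ℝ) 1) :
    lpOneLift v C hv x = ∑' a, x a • v a := rfl

theorem map_lpOneLift (T : F →L[ℝ] G) (v : α → F) (C : ℝ) (hv : ∀ a, ‖v a‖ ≤ C)
    (x : lp (fun _ : α => ℝ) 1) : T (lpOneLift v C hv x) = ∑' a, x a • T (v a) := by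
  rw [lpOneLift_apply, T.map_tsum (summable_norm_smul_lp_one hv x).of_norm]
  simp

theorem norm_lpOneLift_le {v : α → F} {w : α → ℝ} {C D : ℝ} (hv : ∀ a, ‖v a‖ ≤ C)
    (hw : ∀ a, ‖w a‖ ≤ D) (hvw : ∀ a, ‖v a‖ ≤ w a) {x : lp (fun _ : α => ℝ) 1}
    (hx : ∀ a, 0 ≤ x a) : ‖lpOneLift v C hv x‖ ≤ lpOneLift w D hw x := by
  refine (norm_tsum_le_tsum_norm (summable_norm_smul_lp_one hv x)).trans ?_
  refine (summable_norm_smul_lp_one hv x).tsum_le_tsum (fun a => ?_)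
    (summable_norm_smul_lp_one hw x).of_norm
  rw [norm_smul, Real.norm_of_nonneg (hx a), smul_eq_mul]
  exact mul_le_mul_of_nonneg_left (hvw a) (hx a)

theorem hasSum_fiber_iff {ι β : Type*} [DecidableEq ι] (i : ι) (g : β → ℝ) (s : ℝ) :
    HasSum (fun q : ι × β => if q.1 = i then g q.2 else 0) s ↔ HasSum g s := by
  have hinj : Function.Injective fun b : β => (i, b) := fun b c h => (Prod.mk.inj h).2
  rw [← hinj.hasSum_iff]
  · exact Iff.of_eq (congrArg (HasSum · s) (funext fun b => by simp))
  · rintro ⟨j, b⟩ hq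
    rw [if_neg]
    rintro rfl
    exact hq ⟨b, rfl⟩

theorem tsum_fiber {ι β : Type*} [DecidableEq ι] (i : ι) (g : β → ℝ) :
    ∑' q : ι × β, (if q.1 = i then g q.2 else 0) = ∑' b, g b := by
  by_cases hg : Summable g
  · exact ((hasSum_fiber_iff i g _).2 hg.hasSum).tsum_eq
  · rw [tsum_eq_zero_of_not_summable hg, tsum_eq_zero_of_not_summable]
    exact fun ⟨s, hs⟩ => hg ⟨s, (hasSum_fiber_iff i g s).1 hs⟩

end SummableFamilies

theorem lpOne_tsum_single {α : Type*} [DecidableEq α] (a : α) (c : ℝ) :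
    lp.tsumCLM ℝ α ℝ (lp.single 1 a c) = c := by
  rw [lp.tsumCLM_apply, tsum_eq_single a]
  · simp
  · intro b hb
    simp [hb]

section Model

variable {M : ℕ}

theorem hasSum_abs_intensity_row {m : ℕ → ℝ} {k : ℕ} (hoff : ∀ j, k ≠ j → 0 ≤ m j) (hdiag : m k ≤ 0)
    (hsum : Summable m) (hrow : ∑' j, m j = 0) : HasSum (fun j => |m j|) (2 * |m k|) := by
  have h := (hrow ▸ hsum.hasSum).add (hasSum_ite_eq k (-2 * m k))
  convert! h using 1
  · funext j
    by_cases hj : j = k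
    · subst hj
      rw [abs_of_nonpos hdiag, if_pos rfl]
      ring
    · rw [abs_of_nonneg (hoff j (Ne.symm hj)), if_neg hj, add_zero]
  · rw [abs_of_nonpos hdiag]
    ring

theorem exists_intensityCLM (μ : Fin (M + 1) → ℕ → ℕ → ℝ)
    (hμ_off : ∀ (i : Fin (M + 1)) (k j : ℕ), k ≠ j → 0 ≤ μ i k j)
    (hμ_diag : ∀ (i : Fin (M + 1)) (k : ℕ), μ i k k ≤ 0)
    (hμ_row_summable : ∀ (i : Fin (M + 1)) (k : ℕ), Summable (μ i k))
    (hμ_row : ∀ (i : Fin (M + 1)) (k : ℕ), ∑' j : ℕ, μ i k j = 0)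
    (hμ_bdd : ∀ i : Fin (M + 1), BddAbove (Set.range fun k : ℕ => |μ i k k|)) :
    ∃ A : SLIl1 M →L[ℝ] SLIl1 M,
      (∀ y q, A y q = ∑' k : ℕ, μ q.1 k q.2 * y (q.1, k)) ∧
      ∀ y, lp.tsumCLM ℝ (Fin (M + 1) × ℕ) ℝ (A y) = 0 := by
  choose c hc using hμ_bdd
  obtain ⟨C, hC⟩ := (Set.finite_range c).bddAbove
  have habs : ∀ i k, HasSum (fun j => |μ i k j|) (2 * |μ i k k|) := fun i k =>
    hasSum_abs_intensity_row (hμ_off i k) (hμ_diag i k) (hμ_row_summable i k) (hμ_row i k)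
  have hfib : ∀ p : Fin (M + 1) × ℕ, HasSum
      (fun q : Fin (M + 1) × ℕ => |if q.1 = p.1 then μ p.1 p.2 q.2 else 0|)
      (2 * |μ p.1 p.2 p.2|) := fun p => by
    convert! (hasSum_fiber_iff p.1 (fun j => |μ p.1 p.2 j|) _).2 (habs p.1 p.2) using 2 with q
    split_ifs <;> simp
  let v : Fin (M + 1) × ℕ → SLIl1 M := fun p =>
    ⟨fun q => if q.1 = p.1 then μ p.1 p.2 q.2 else 0, memℓp_one_of_summable (hfib p).summable⟩
  have hv : ∀ p, ‖v p‖ ≤ 2 * C := fun p => by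
    rw [norm_lp_one]
    refine (hfib p).tsum_eq.trans_le ?_
    have h1 : |μ p.1 p.2 p.2| ≤ c p.1 := hc p.1 ⟨p.2, rfl⟩
    have h2 : c p.1 ≤ C := hC ⟨p.1, rfl⟩
    linarith
  refine ⟨lpOneLift v (2 * C) hv, fun y q => ?_, fun y => ?_⟩
  · refine (map_lpOneLift (lp.evalCLM ℝ (fun _ : Fin (M + 1) × ℕ => ℝ) 1 q) v _ hv y).trans ?_
    rw [← tsum_fiber q.1 fun k => μ q.1 k q.2 * y (q.1, k)]
    refine tsum_congr fun p => ?_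
    change y p * (if q.1 = p.1 then μ p.1 p.2 q.2 else 0) = _
    obtain ⟨i, k⟩ := p
    by_cases h : i = q.1
    · subst h
      simp [mul_comm]
    · simp [h, Ne.symm h]
  · rw [map_lpOneLift]
    convert tsum_zero with p
    have : lp.tsumCLM ℝ (Fin (M + 1) × ℕ) ℝ (v p) = 0 := by
      rw [lp.tsumCLM_apply]
      exact (tsum_fiber p.1 (μ p.1 p.2)).trans (hμ_row _ _)
    rw [this, smul_zero]

theorem norm_normalized_smul_sub_le {V W : Type*} [NormedAddCommGroup V] [NormedSpace ℝ V]
    [NormedAddCommGroup W] [NormedSpace ℝ W] (S T : V →L[ℝ] ℝ) (B : V →L[ℝ] W) {c : ℝ}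
    (hc : 0 ≤ c) {x y : V} (hSx : 0 ≤ S x) (hTx : 0 ≤ T x) (hSy : 0 ≤ S y) (hTy : 0 ≤ T y)
    (hx : S x ≤ c * T x) (hy : S y ≤ c * T y) (hB : ‖B y‖ ≤ 2 * T y) :
    ‖(S x / T x) • B x - (S y / T y) • B y‖ ≤ (c * ‖B‖ + 2 * (c * ‖T‖ + ‖S‖)) * ‖x - y‖ := by
  have hr : S x / T x ≤ c := div_le_of_le_mul₀ hTx hc hx
  have hr0 : 0 ≤ S x / T x := div_nonneg hSx hTx
  have hmul : ∀ z, 0 ≤ S z → 0 ≤ T z → S z ≤ c * T z → S z / T z * T z = S z := fun z h0 _ h => by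
    by_cases hz : T z = 0
    · rw [hz, mul_zero] at h
      rw [hz, mul_zero]
      exact le_antisymm h0 h
    · exact div_mul_cancel₀ _ hz
  have hxm := hmul x hSx hTx hx
  have hym := hmul y hSy hTy hy
  have e : (S x / T x) • B x - (S y / T y) • B y
      = (S x / T x) • B (x - y) + (S x / T x - S y / T y) • B y := by
    rw [map_sub, smul_sub, sub_smul]
    abel
  have e2 : (S x / T x - S y / T y) * T y = S (x - y) - S x / T x * T (x - y) := by
    rw [map_sub, map_sub]
    linear_combination -hym + hxm
  have h1 : ‖(S x / T x) • B (x - y)‖ ≤ c * (‖B‖ * ‖x - y‖) := by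
    rw [norm_smul, Real.norm_of_nonneg hr0]
    exact mul_le_mul hr (B.le_opNorm _) (norm_nonneg _) hc
  have h2 : ‖(S x / T x - S y / T y) • B y‖ ≤ 2 * (‖S‖ * ‖x - y‖ + c * (‖T‖ * ‖x - y‖)) := by
    calc _ = |S x / T x - S y / T y| * ‖B y‖ := by rw [norm_smul, Real.norm_eq_abs]
      _ ≤ |S x / T x - S y / T y| * (2 * T y) := by gcongr
      _ = 2 * |(S x / T x - S y / T y) * T y| := by
        rw [abs_mul, abs_of_nonneg hTy]
        ring
      _ ≤ 2 * (‖S‖ * ‖x - y‖ + c * (‖T‖ * ‖x - y‖)) := by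
        rw [e2]
        gcongr
        refine (abs_sub _ _).trans ?_
        gcongr
        · exact S.le_opNorm _
        · rw [abs_mul, abs_of_nonneg hr0]
          exact mul_le_mul hr (T.le_opNorm _) (abs_nonneg _) hc
  rw [e]
  refine (norm_add_le _ _).trans ?_
  linarith

theorem exists_transition (f : ℕ → ℝ) {fl fu : ℝ} (hfl : 0 < fl)
    (hf : ∀ j : ℕ, fl ≤ f j ∧ f j ≤ fu) (i : Fin (M + 1)) :
    ∃ (R : SLIl1 M → SLIl1 M) (K : ℝ), 0 ≤ K ∧
      (∀ x y, (∀ q, 0 ≤ x q) → (∀ q, 0 ≤ y q) → ‖R x - R y‖ ≤ K * ‖x - y‖) ∧ R 0 = 0 ∧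
      (∀ y q, R y q = (∑' l, y (i, l)) / (∑' l, f l * y (i, l)) *
        (f q.2 * y (i, q.2) * ((if q.1 = i + 1 then 1 else 0) - if q.1 = i then 1 else 0))) ∧
      ∀ y, lp.tsumCLM ℝ (Fin (M + 1) × ℕ) ℝ (R y) = 0 := by
  have hf0 : ∀ j, 0 ≤ f j := fun j => hfl.le.trans (hf j).1
  have hfu : 0 ≤ fu := (hf0 0).trans (hf 0).2
  let w : Fin (M + 1) × ℕ → ℝ := fun p => if p.1 = i then 1 else 0
  let wf : Fin (M + 1) × ℕ → ℝ := fun p => if p.1 = i then f p.2 else 0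
  let v : Fin (M + 1) × ℕ → SLIl1 M := fun p =>
    wf p • (lp.single 1 (i + 1, p.2) (1 : ℝ) - lp.single 1 (i, p.2) (1 : ℝ))
  have hw0 : ∀ p, 0 ≤ w p := fun p => by
    simp only [w]
    split_ifs <;> norm_num
  have hw : ∀ p, ‖w p‖ ≤ 1 := fun p => by
    simp only [w]
    split_ifs <;> simp
  have hwf0 : ∀ p, 0 ≤ wf p := fun p => by
    simp only [wf]
    split_ifs
    exacts [hf0 _, le_rfl]
  have hwf : ∀ p, ‖wf p‖ ≤ fu := fun p => by
    rw [Real.norm_of_nonneg (hwf0 p)]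
    simp only [wf]
    split_ifs
    exacts [(hf _).2, hfu]
  have hv' : ∀ p, ‖v p‖ ≤ 2 * wf p := fun p => by
    simp only [v]
    rw [norm_smul, Real.norm_of_nonneg (hwf0 p), mul_comm]
    refine mul_le_mul_of_nonneg_right ?_ (hwf0 p)
    refine (norm_sub_le _ _).trans ?_
    rw [lp.norm_single one_pos, lp.norm_single one_pos]
    norm_num
  have hv : ∀ p, ‖v p‖ ≤ 2 * fu := fun p => by
    have := (Real.norm_of_nonneg (hwf0 p)).symm.trans_le (hwf p)
    linarith [hv' p]
  have h2wf : ∀ p, ‖2 * wf p‖ ≤ 2 * fu := fun p => by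
    rw [norm_mul]
    simpa using hwf p
  let S := lpOneLift w 1 hw
  let T := lpOneLift wf fu hwf
  let B := lpOneLift v (2 * fu) hv
  have hS : ∀ y, S y = ∑' l, y (i, l) := fun y => by
    rw [← tsum_fiber i fun l => y (i, l)]
    refine tsum_congr fun ⟨j, l⟩ => ?_
    by_cases h : j = i
    · subst h
      simp [w]
    · simp [w, h]
  have hT : ∀ y, T y = ∑' l, f l * y (i, l) := fun y => by
    rw [← tsum_fiber i fun l => f l * y (i, l)]
    refine tsum_congr fun ⟨j, l⟩ => ?_
    by_cases h : j = i
    · subst h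
      simp [wf, mul_comm]
    · simp [wf, h]
  have hST : ∀ y : SLIl1 M, (∀ q, 0 ≤ y q) → 0 ≤ S y ∧ 0 ≤ T y ∧ S y ≤ 1 / fl * T y ∧
      ‖B y‖ ≤ 2 * T y := fun y hy => by
    refine ⟨tsum_nonneg fun p => mul_nonneg (hy p) (hw0 p),
      tsum_nonneg fun p => mul_nonneg (hy p) (hwf0 p), ?_, ?_⟩
    · rw [one_div, inv_mul_eq_div, le_div_iff₀ hfl]
      change (∑' p, y p • w p) * fl ≤ ∑' p, y p • wf p
      rw [← tsum_mul_right]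
      refine Summable.tsum_le_tsum (fun p => ?_)
        ((summable_norm_smul_lp_one hw y).of_norm.mul_right fl)
        (summable_norm_smul_lp_one hwf y).of_norm
      simp only [smul_eq_mul, mul_assoc]
      refine mul_le_mul_of_nonneg_left ?_ (hy p)
      simp only [w, wf]
      split_ifs
      · simpa using (hf p.2).1
      · simp
    · refine (norm_lpOneLift_le hv h2wf hv' hy).trans_eq ?_
      change ∑' p, y p • (2 * wf p) = 2 * ∑' p, y p • wf p
      rw [← tsum_mul_left]
      refine tsum_congr fun p => ?_
      simp only [smul_eq_mul]
      ring
  have htot : ∀ y, lp.tsumCLM ℝ (Fin (M + 1) × ℕ) ℝ (B y) = 0 := fun y => by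
    rw [map_lpOneLift]
    convert tsum_zero with p
    simp only [v]
    rw [map_smul, map_sub, lpOne_tsum_single, lpOne_tsum_single]
    simp
  have hB : ∀ y q, B y q =
      f q.2 * y (i, q.2) * ((if q.1 = i + 1 then 1 else 0) - if q.1 = i then 1 else 0) := by
    rintro y ⟨j, l⟩
    refine (map_lpOneLift (lp.evalCLM ℝ (fun _ : Fin (M + 1) × ℕ => ℝ) 1 (j, l)) v _ hv y).trans ?_
    have hvq : ∀ p, lp.evalCLM ℝ (fun _ : Fin (M + 1) × ℕ => ℝ) 1 (j, l) (v p) =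
        wf p * ((if (j, l) = (i + 1, p.2) then 1 else 0) - if (j, l) = (i, p.2) then 1 else 0) :=
      fun p => by
        change wf p * ((lp.single 1 (i + 1, p.2) (1 : ℝ) : SLIl1 M) (j, l) -
          (lp.single 1 (i, p.2) (1 : ℝ) : SLIl1 M) (j, l)) = _
        rw [lp.single_apply, lp.single_apply, Pi.single_apply, Pi.single_apply]
    simp only [hvq]
    rw [tsum_eq_single (i, l)]
    · simp [wf]
      ring
    · rintro ⟨k, n⟩ hp
      by_cases hk : k = i
      · subst hk
        have hn : l ≠ n := fun h => hp (by rw [h])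
        simp [hn]
      · simp [wf, hk]
  refine ⟨fun y => (S y / T y) • B y, 1 / fl * ‖B‖ + 2 * (1 / fl * ‖T‖ + ‖S‖), by positivity,
    fun x y hx hy => ?_, by simp, fun y q => ?_, fun y => ?_⟩
  · obtain ⟨hx1, hx2, hx3, -⟩ := hST x hx
    obtain ⟨hy1, hy2, hy3, hy4⟩ := hST y hy
    exact norm_normalized_smul_sub_le S T B (by positivity) hx1 hx2 hy1 hy2 hx3 hy3 hy4
  · rw [← hS, ← hT, ← hB]
    rfl
  · rw [map_smul, htot, smul_zero]

theorem psiFun_nonneg {M : ℕ} {μ : Fin (M + 1) → ℕ → ℕ → ℝ} {lam : ℝ → Fin (M + 1) → ℝ}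
    {f : ℕ → ℝ} (hf : ∀ j, 0 ≤ f j) (hlam : ∀ t i, 0 ≤ lam t i)
    (hμ_off : ∀ (i : Fin (M + 1)) (k j : ℕ), k ≠ j → 0 ≤ μ i k j) (t : ℝ)
    {y : Fin (M + 1) × ℕ → ℝ} (hy : ∀ q, 0 ≤ y q) {q : Fin (M + 1) × ℕ} (hq : y q = 0) :
    0 ≤ PsiFun M μ lam f t y q := by
  obtain ⟨i, j⟩ := q
  have h1 : 0 ≤ ∑' k, μ i k j * y (i, k) := tsum_nonneg fun k => by
    by_cases hk : k = j
    · rw [hk, hq, mul_zero]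
    · exact mul_nonneg (hμ_off i k j hk) (hy _)
  have h2 : 0 ≤ lam t (i - 1) * f j * y (i - 1, j) * (∑' l, y (i - 1, l)) /
      ∑' l, f l * y (i - 1, l) :=
    div_nonneg (mul_nonneg (mul_nonneg (mul_nonneg (hlam _ _) (hf _)) (hy _))
      (tsum_nonneg fun l => hy _)) (tsum_nonneg fun l => mul_nonneg (hf l) (hy _))
  have h3 : lam t i * f j * y (i, j) * (∑' l, y (i, l)) / ∑' l, f l * y (i, l) = 0 := by
    rw [hq]
    simp
  simp only [PsiFun]
  rw [h3, ite_self, sub_zero]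
  refine add_nonneg h1 ?_
  split_ifs
  exacts [h2, le_rfl]

theorem exists_drift (M : ℕ) (μ : Fin (M + 1) → ℕ → ℕ → ℝ)
    (lam : ℝ → Fin (M + 1) → ℝ) (f : ℕ → ℝ) (fl fu lamBar : ℝ)
    (hfl : 0 < fl) (hf : ∀ j : ℕ, fl ≤ f j ∧ f j ≤ fu)
    (hlamBar : 0 ≤ lamBar) (hlam : ∀ (t : ℝ) (i : Fin (M + 1)), 0 ≤ lam t i ∧ lam t i ≤ lamBar)
    (hlam_meas : ∀ i : Fin (M + 1), Measurable fun t => lam t i)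
    (hlam_last : ∀ t : ℝ, lam t (Fin.last M) = 0)
    (hμ_off : ∀ (i : Fin (M + 1)) (k j : ℕ), k ≠ j → 0 ≤ μ i k j)
    (hμ_diag : ∀ (i : Fin (M + 1)) (k : ℕ), μ i k k ≤ 0)
    (hμ_row_summable : ∀ (i : Fin (M + 1)) (k : ℕ), Summable (μ i k))
    (hμ_row : ∀ (i : Fin (M + 1)) (k : ℕ), ∑' j : ℕ, μ i k j = 0)
    (hμ_bdd : ∀ i : Fin (M + 1), BddAbove (Set.range fun k : ℕ => |μ i k k|)) :
    ∃ (F : ℝ → SLIl1 M → SLIl1 M) (L : ℝ), 0 < L ∧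
      (∀ t x y, ‖F t x - F t y‖ ≤ L * ‖x - y‖) ∧ (∀ t, F t 0 = 0) ∧
      (∀ u : ℝ → SLIl1 M, Continuous u → AEStronglyMeasurable (fun s => F s (u s)) volume) ∧
      (∀ t x q, F t x q = PsiFun M μ lam f t (fun r => max (x r) 0) q) ∧
      ∀ t x, lp.tsumCLM ℝ (Fin (M + 1) × ℕ) ℝ (F t x) = 0 := by
  obtain ⟨A, hA, hAtot⟩ :=
    exists_intensityCLM μ hμ_off hμ_diag hμ_row_summable hμ_row hμ_bdd
  choose R K hK hRlip hR0 hR hRtot using exists_transition (M := M) f hfl hf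
  have hpos : ∀ (x : SLIl1 M) q, 0 ≤ lpOnePos x q := fun x q => le_max_right _ _
  have hlip : ∀ i x y, ‖R i (lpOnePos x) - R i (lpOnePos y)‖ ≤ K i * ‖x - y‖ := fun i x y =>
    (hRlip i _ _ (hpos x) (hpos y)).trans
      (mul_le_mul_of_nonneg_left (norm_lpOnePos_sub_le x y) (hK i))
  have hposc : Continuous (lpOnePos : SLIl1 M → SLIl1 M) :=
    (LipschitzWith.of_dist_le_mul (K := 1) fun x y => by
      rw [dist_eq_norm, dist_eq_norm, NNReal.coe_one, one_mul]
      exact norm_lpOnePos_sub_le x y).continuous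
  have hRc : ∀ i, Continuous fun x => R i (lpOnePos x) := fun i =>
    (LipschitzWith.of_dist_le_mul (K := ⟨K i, hK i⟩) fun x y => by
      rw [dist_eq_norm, dist_eq_norm]
      exact hlip i x y).continuous
  have hpos0 : lpOnePos (0 : SLIl1 M) = 0 := by
    ext q
    simp [lpOnePos_apply]
  have hsum : 0 ≤ ∑ i, lamBar * K i := Finset.sum_nonneg fun i _ => mul_nonneg hlamBar (hK i)
  refine ⟨fun t x => A (lpOnePos x) + ∑ i, lam t i • R i (lpOnePos x),
    ‖A‖ + ∑ i, lamBar * K i + 1, by positivity, fun t x y => ?_, fun t => ?_, fun u hu => ?_,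
    fun t x q => ?_, fun t x => ?_⟩
  · have e : A (lpOnePos x) + ∑ i, lam t i • R i (lpOnePos x)
        - (A (lpOnePos y) + ∑ i, lam t i • R i (lpOnePos y))
        = A (lpOnePos x - lpOnePos y)
          + ∑ i, lam t i • (R i (lpOnePos x) - R i (lpOnePos y)) := by
      simp only [map_sub, smul_sub, Finset.sum_sub_distrib]
      abel
    rw [e]
    have h1 : ‖A (lpOnePos x - lpOnePos y)‖ ≤ ‖A‖ * ‖x - y‖ :=
      (A.le_opNorm _).trans (mul_le_mul_of_nonneg_left (norm_lpOnePos_sub_le x y) (norm_nonneg _))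
    have h2 : ‖∑ i, lam t i • (R i (lpOnePos x) - R i (lpOnePos y))‖
        ≤ (∑ i, lamBar * K i) * ‖x - y‖ := by
      rw [Finset.sum_mul]
      refine norm_sum_le_of_le _ fun i _ => ?_
      rw [norm_smul, Real.norm_of_nonneg (hlam t i).1, mul_assoc]
      exact mul_le_mul (hlam t i).2 (hlip i x y) (norm_nonneg _) hlamBar
    refine (norm_add_le _ _).trans ?_
    nlinarith [norm_nonneg (x - y)]
  · simp [hpos0, hR0]
  · refine (A.continuous.comp (hposc.comp hu)).aestronglyMeasurable.add ?_
    refine Finset.aestronglyMeasurable_fun_sum _ fun i _ => ?_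
    exact (hlam_meas i).aestronglyMeasurable.smul ((hRc i).comp hu).aestronglyMeasurable
  · have hcoe : (A (lpOnePos x) + ∑ i, lam t i • R i (lpOnePos x)) q
        = A (lpOnePos x) q + ∑ i, lam t i * R i (lpOnePos x) q := by
      have := map_sum (lp.evalCLM ℝ (fun _ : Fin (M + 1) × ℕ => ℝ) 1 q)
        (fun i => lam t i • R i (lpOnePos x)) Finset.univ
      exact congrArg (A (lpOnePos x) q + ·) this
    rw [hcoe, hA]
    simp only [hR, PsiFun, lpOnePos_apply]
    obtain ⟨j, n⟩ := q
    simp only [mul_sub, Finset.sum_sub_distrib, mul_ite, mul_one, mul_zero]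
    have hswap : ∀ i : Fin (M + 1), (j = i + 1) = (j - 1 = i) := fun i =>
      propext sub_eq_iff_eq_add.symm
    simp only [hswap, Finset.sum_ite_eq, Finset.mem_univ, if_true]
    rw [add_sub_assoc]
    congr 1
    congr 1
    · by_cases hj : 1 ≤ (j : ℕ)
      · rw [if_pos hj]
        ring
      · have hj0 : j = 0 := Fin.ext (by simpa using hj)
        have hl : j - 1 = Fin.last M := by
          rw [hj0, sub_eq_iff_eq_add]
          exact (Fin.last_add_one M).symm
        rw [if_neg hj, hl, hlam_last, zero_mul]
    · by_cases hj : (j : ℕ) < M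
      · rw [if_pos hj]
        ring
      · have hl : j = Fin.last M := Fin.ext (by simp; omega)
        rw [if_neg hj, hl, hlam_last, zero_mul]
  · rw [map_add, hAtot, map_sum]
    simp [hRtot]

theorem nonneg_of_integral_eq {p g : ℝ → ℝ} (hp : Continuous p)
    (hg : ∀ a b, IntervalIntegrable g volume a b) (hp0 : 0 ≤ p 0)
    (hpg : ∀ t, 0 ≤ t → p t = p 0 + ∫ s in (0 : ℝ)..t, g s) (hneg : ∀ t, p t ≤ 0 → 0 ≤ g t)
    {t : ℝ} (ht : 0 ≤ t) : 0 ≤ p t := by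
  by_contra! hpt
  have hc : IsCompact (Icc 0 t ∩ p ⁻¹' Ici 0) :=
    isCompact_Icc.inter_right (isClosed_Ici.preimage hp)
  obtain ⟨r, ⟨⟨hr0, hrt⟩, hpr⟩, hmax⟩ := hc.exists_isGreatest ⟨0, ⟨le_rfl, ht⟩, hp0⟩
  have hle : ∀ s ∈ Ioc r t, p s ≤ 0 := fun s hs => by
    by_contra! h
    exact hs.1.not_ge (hmax ⟨⟨hr0.trans hs.1.le, hs.2⟩, h.le⟩)
  have hint : 0 ≤ ∫ s in r..t, g s := by
    rw [intervalIntegral.integral_of_le hrt]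
    exact setIntegral_nonneg measurableSet_Ioc fun s hs => hneg s (hle s hs)
  have hadd := intervalIntegral.integral_add_adjacent_intervals (hg 0 r) (hg r t)
  have h1 := hpg r hr0
  have h2 := hpg t ht
  have hpr' : 0 ≤ p r := hpr
  linarith

end Model

/-- For the initial condition `P₀ = δ_{(x₀,y₀)}`, the equation
`P(t) = P₀ + ∫₀ᵗ Ψ₊(s, P(s)) ds` (Bochner integral in `E = ℓ¹(ℒ_M × ℕ)`) has a unique
continuous solution `P : [0,∞) → E`, and this solution is componentwise nonnegative with
`|P(t)| = 1` for all `t ≥ 0`. -/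
theorem fokkerPlanck_plus_wellposed (M : ℕ) (μ : Fin (M + 1) → ℕ → ℕ → ℝ)
    (lam : ℝ → Fin (M + 1) → ℝ) (f : ℕ → ℝ) (fl fu lamBar : ℝ)
    -- bounds on `f`
    (hfl : 0 < fl) (hf : ∀ j : ℕ, fl ≤ f j ∧ f j ≤ fu)
    -- assumptions on the local intensity `λ`
    (hlamBar : 0 ≤ lamBar) (hlam : ∀ (t : ℝ) (i : Fin (M + 1)), 0 ≤ lam t i ∧ lam t i ≤ lamBar)
    (hlam_meas : ∀ i : Fin (M + 1), Measurable fun t => lam t i)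
    (hlam_last : ∀ t : ℝ, lam t (Fin.last M) = 0)
    -- `μ^i` is an intensity matrix for every `i`
    (hμ_off : ∀ (i : Fin (M + 1)) (k j : ℕ), k ≠ j → 0 ≤ μ i k j)
    (hμ_diag : ∀ (i : Fin (M + 1)) (k : ℕ), μ i k k ≤ 0)
    (hμ_row_summable : ∀ (i : Fin (M + 1)) (k : ℕ), Summable (μ i k))
    (hμ_row : ∀ (i : Fin (M + 1)) (k : ℕ), ∑' j : ℕ, μ i k j = 0)
    (hμ_bdd : ∀ i : Fin (M + 1), BddAbove (Set.range fun k : ℕ => |μ i k k|))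
    -- initial condition
    (x₀ : Fin (M + 1)) (y₀ : ℕ) :
    ∃ P : ℝ → SLIl1 M,
      (ContinuousOn P (Ici 0) ∧
        ∃ G : ℝ → SLIl1 M,
          (∀ s ∈ Ici (0 : ℝ), ∀ q,
              G s q = PsiFun M μ lam f s (fun r => max (P s r) 0) q) ∧
          ∀ t ∈ Ici (0 : ℝ),
            P t = lp.single 1 (x₀, y₀) (1 : ℝ) + ∫ s in Ioc (0 : ℝ) t, G s) ∧
      -- the solution is nonnegative with total mass one
      (∀ t ∈ Ici (0 : ℝ), ∀ q, 0 ≤ P t q) ∧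
      (∀ t ∈ Ici (0 : ℝ), ‖P t‖ = 1) ∧
      -- uniqueness
      ∀ Q : ℝ → SLIl1 M,
        (ContinuousOn Q (Ici 0) ∧
          ∃ G : ℝ → SLIl1 M,
            (∀ s ∈ Ici (0 : ℝ), ∀ q,
                G s q = PsiFun M μ lam f s (fun r => max (Q s r) 0) q) ∧
            ∀ t ∈ Ici (0 : ℝ),
              Q t = lp.single 1 (x₀, y₀) (1 : ℝ) + ∫ s in Ioc (0 : ℝ) t, G s) →
        EqOn Q P (Ici 0) := by
  obtain ⟨F, L, hL, hlip, hzero, hmeas, hF, hFtot⟩ :=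
    exists_drift M μ lam f fl fu lamBar hfl hf hlamBar hlam hlam_meas hlam_last hμ_off hμ_diag
      hμ_row_summable hμ_row hμ_bdd
  obtain ⟨P, hPc, hP⟩ :=
    caratheodory_exists hL hlip hzero hmeas (lp.single 1 (x₀, y₀) (1 : ℝ) : SLIl1 M)
  have hii := intervalIntegrable_caratheodory hlip hzero hmeas hPc
  have hP0 : P 0 = lp.single 1 (x₀, y₀) (1 : ℝ) := by simpa using hP 0 le_rfl
  have hmap : ∀ (T : SLIl1 M →L[ℝ] ℝ) t, 0 ≤ t →
      T (P t) = T (P 0) + ∫ s in (0 : ℝ)..t, T (F s (P s)) := fun T t ht => by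
    rw [hP t ht, map_add, ← hP0, T.intervalIntegral_comp_comm (hii 0 t)]
  have hnonneg : ∀ t ∈ Ici (0 : ℝ), ∀ q, 0 ≤ P t q := fun t ht q => by
    let T := lp.evalCLM ℝ (fun _ : Fin (M + 1) × ℕ => ℝ) 1 q
    refine nonneg_of_integral_eq (p := fun t => T (P t)) (g := fun s => T (F s (P s)))
      (T.continuous.comp hPc) (fun a b => ?_) ?_ (hmap T) (fun s hs => ?_) ht
    · exact ⟨T.integrable_comp (hii a b).1, T.integrable_comp (hii a b).2⟩
    · change 0 ≤ P 0 q
      rw [hP0, lp.single_apply, Pi.single_apply]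
      split_ifs <;> norm_num
    · change 0 ≤ F s (P s) q
      rw [hF]
      exact psiFun_nonneg (fun j => hfl.le.trans (hf j).1) (fun t i => (hlam t i).1) hμ_off s
        (fun r => le_max_right _ _) (max_eq_right hs)
  refine ⟨P, ⟨hPc.continuousOn, fun s => F s (P s), fun s _ q => hF s (P s) q, fun t ht => ?_⟩,
    hnonneg, fun t ht => ?_, ?_⟩
  · rw [← intervalIntegral.integral_of_le ht]
    exact hP t ht
  · have h := hmap (lp.tsumCLM ℝ (Fin (M + 1) × ℕ) ℝ) t ht
    simp only [hFtot, intervalIntegral.integral_zero, add_zero] at h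
    rw [hP0, lpOne_tsum_single, lp.tsumCLM_apply] at h
    rw [norm_lp_one, ← h]
    exact tsum_congr fun q => abs_of_nonneg (hnonneg t ht q)
  · rintro Q ⟨hQc, G, hG, hQ⟩
    refine caratheodory_unique hlip hzero hmeas hQc hPc.continuousOn (fun t ht => ?_) hP
    rw [hQ t ht, intervalIntegral.integral_of_le ht]
    congr 1
    refine setIntegral_congr_fun measurableSet_Ioc fun s hs => ?_
    ext q
    exact (hG s hs.1.le q).trans (hF s (Q s) q).symm
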